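/- Let f be an admissible element of (rad R(E₆))², where R(E₆) = K⟨x,y⟩/(x², y³, (x+y)³). Then the deformed preprojective algebra P^f(E₆) is isomorphic as a K-algebra to the preprojective algebra P(E₆). -/

import Mathlib

noncomputable section

open FreeAlgebra

/-- Generators of the path algebra of the double quiver of `E₆`:
trivial paths `e v` at the vertices `0,…,5`, arrows `a i` and reversed arrows `abar i`. -/
inductive E6Gen : Type
  | e : Fin 6 → E6Gen
  | a : Fin 5 → E6Gen
  | abar : Fin 5 → E6Gen
  deriving DecidableEq

/-- Sources of the arrows `a₀ : 0 → 3`, `a₁ : 1 → 2`, `a₂ : 2 → 3`, `a₃ : 3 → 4`, `a₄ : 4 → 5`. -/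
def asrc : Fin 5 → Fin 6 := ![0, 1, 2, 3, 4]

/-- Targets of the arrows `a₀ : 0 → 3`, `a₁ : 1 → 2`, `a₂ : 2 → 3`, `a₃ : 3 → 4`, `a₄ : 4 → 5`. -/
def atgt : Fin 5 → Fin 6 := ![3, 2, 3, 4, 5]

variable (K : Type*) [Field K]

/-- Shorthand for the generator `e v` in the free algebra. -/
def eF (v : Fin 6) : FreeAlgebra K E6Gen := ι K (E6Gen.e v)

/-- Shorthand for the generator `a i` in the free algebra. -/
def aF (i : Fin 5) : FreeAlgebra K E6Gen := ι K (E6Gen.a i)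

/-- Shorthand for the generator `ā i` in the free algebra. -/
def abF (i : Fin 5) : FreeAlgebra K E6Gen := ι K (E6Gen.abar i)

/-- The defining relations of the preprojective algebra `P(E₆)`: the path-algebra
relations for the double quiver of `E₆` (orthogonal idempotents summing to `1`,
composability of arrows with trivial paths, products written in path order,
i.e. `a₂ * a₃` is "first `a₂ : 2 → 3`, then `a₃ : 3 → 4`") together with the
preprojective relations. -/
inductive PRel : FreeAlgebra K E6Gen → FreeAlgebra K E6Gen → Prop
  | idem (v w : Fin 6) : PRel (eF K v * eF K w) (if v = w then eF K v else 0)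
  | sum_idem : PRel (∑ v : Fin 6, eF K v) 1
  | srcA (i : Fin 5) : PRel (eF K (asrc i) * aF K i) (aF K i)
  | tgtA (i : Fin 5) : PRel (aF K i * eF K (atgt i)) (aF K i)
  | srcAb (i : Fin 5) : PRel (eF K (atgt i) * abF K i) (abF K i)
  | tgtAb (i : Fin 5) : PRel (abF K i * eF K (asrc i)) (abF K i)
  | pre0 : PRel (aF K 0 * abF K 0) 0
  | pre1 : PRel (aF K 1 * abF K 1) 0
  | pre2 : PRel (abF K 1 * aF K 1 + aF K 2 * abF K 2) 0
  | pre3 : PRel (abF K 0 * aF K 0 + abF K 2 * aF K 2 + aF K 3 * abF K 3) 0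
  | pre4 : PRel (abF K 3 * aF K 3 + aF K 4 * abF K 4) 0
  | pre5 : PRel (abF K 4 * aF K 4) 0

/-- The preprojective algebra `P(E₆)`. -/
abbrev PE6 := RingQuot (PRel K)

/-- The trivial path `e v` in `P(E₆)`. -/
def pe (v : Fin 6) : PE6 K := RingQuot.mkAlgHom K (PRel K) (eF K v)

/-- The arrow `a i` in `P(E₆)`. -/
def pa (i : Fin 5) : PE6 K := RingQuot.mkAlgHom K (PRel K) (aF K i)

/-- The arrow `ā i` in `P(E₆)`. -/
def pab (i : Fin 5) : PE6 K := RingQuot.mkAlgHom K (PRel K) (abF K i)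

/-- The defining relations of `R(E₆) = K⟨x,y⟩/(x², y³, (x+y)³)`. -/
inductive RRel : FreeAlgebra K (Fin 2) → FreeAlgebra K (Fin 2) → Prop
  | xx : RRel (ι K (0 : Fin 2) * ι K 0) 0
  | yyy : RRel (ι K (1 : Fin 2) * ι K 1 * ι K 1) 0
  | xy3 : RRel ((ι K (0 : Fin 2) + ι K 1) ^ 3) 0

/-- `R(E₆) = K⟨x,y⟩/(x², y³, (x+y)³)`. -/
abbrev RE6 := RingQuot (RRel K)

/-- The image of `x` in `R(E₆)`. -/
def rx : RE6 K := RingQuot.mkAlgHom K (RRel K) (ι K 0)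

/-- The image of `y` in `R(E₆)`. -/
def ry : RE6 K := RingQuot.mkAlgHom K (RRel K) (ι K 1)

/-- The square `(rad R(E₆))²` of the radical of `R(E₆)`, i.e. of the two-sided
ideal generated by `x` and `y`. -/
def radSq : Submodule K (RE6 K) :=
  Submodule.span K
    {z | ∃ p q r g g', (g = rx K ∨ g = ry K) ∧ (g' = rx K ∨ g' = ry K) ∧
      z = p * g * q * g' * r}

/-- Substitution `x ↦ ā₀a₀`, `y ↦ ā₂a₂` from the free algebra on `x, y` into the
free path algebra of the double quiver of `E₆`. -/
def subst : FreeAlgebra K (Fin 2) →ₐ[K] FreeAlgebra K E6Gen :=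
  FreeAlgebra.lift K ![abF K 0 * aF K 0, abF K 2 * aF K 2]

/-- The defining relations of the deformed preprojective algebra `P^f(E₆)`, for a
deformation given by a lift `F` of `f` to the free algebra on `x, y`: the
path-algebra relations of the double quiver of `E₆` together with the deformed
preprojective relations. -/
inductive DRel (F : FreeAlgebra K (Fin 2)) :
    FreeAlgebra K E6Gen → FreeAlgebra K E6Gen → Prop
  | idem (v w : Fin 6) : DRel F (eF K v * eF K w) (if v = w then eF K v else 0)
  | sum_idem : DRel F (∑ v : Fin 6, eF K v) 1
  | srcA (i : Fin 5) : DRel F (eF K (asrc i) * aF K i) (aF K i)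
  | tgtA (i : Fin 5) : DRel F (aF K i * eF K (atgt i)) (aF K i)
  | srcAb (i : Fin 5) : DRel F (eF K (atgt i) * abF K i) (abF K i)
  | tgtAb (i : Fin 5) : DRel F (abF K i * eF K (asrc i)) (abF K i)
  | pre0 : DRel F (aF K 0 * abF K 0) 0
  | pre1 : DRel F (aF K 1 * abF K 1) 0
  | pre2 : DRel F (abF K 1 * aF K 1 + aF K 2 * abF K 2) 0
  | pre3 : DRel F (abF K 0 * aF K 0 + abF K 2 * aF K 2 + aF K 3 * abF K 3 + subst K F) 0
  | pre4 : DRel F (abF K 3 * aF K 3 + aF K 4 * abF K 4) 0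
  | pre5 : DRel F (abF K 4 * aF K 4) 0
  | cube : DRel F ((abF K 0 * aF K 0 + abF K 2 * aF K 2) ^ 3) 0

/-- The deformed preprojective algebra `P^f(E₆)` associated to a lift `F` of `f`. -/
abbrev PfE6 (F : FreeAlgebra K (Fin 2)) := RingQuot (DRel K F)

section RadicalFiltration

variable {K}

lemma rx_mul_rx : rx K * rx K = 0 := by
  simpa [rx] using RingQuot.mkAlgHom_rel K (RRel.xx (K := K))

lemma ry_mul_ry_mul_ry : ry K * (ry K * ry K) = 0 := by
  simpa [ry, mul_assoc] using RingQuot.mkAlgHom_rel K (RRel.yyy (K := K))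

lemma rx_add_ry_pow_three : (rx K + ry K) ^ 3 = 0 := by
  simpa [rx, ry] using RingQuot.mkAlgHom_rel K (RRel.xy3 (K := K))

lemma ry_mul_ry_mul_rx : ry K * (ry K * rx K) =
    (-1 : K) • (rx K * (ry K * rx K) + rx K * (ry K * ry K) + ry K * (rx K * ry K)) := by
  have h := rx_add_ry_pow_three (K := K)
  have h1 : (rx K + ry K) ^ 3 = rx K * rx K * rx K + rx K * rx K * ry K
      + rx K * (ry K * rx K) + rx K * (ry K * ry K) + ry K * (rx K * rx K)
      + ry K * (rx K * ry K) + ry K * (ry K * rx K) + ry K * (ry K * ry K) := by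
    noncomm_ring
  rw [h1, rx_mul_rx, ry_mul_ry_mul_ry] at h
  simp only [zero_mul, mul_zero, zero_add, add_zero] at h
  rw [← sub_eq_zero, ← h]
  module

lemma rx_mul_rx_mul (r : RE6 K) : rx K * (rx K * r) = 0 := by
  rw [← mul_assoc, rx_mul_rx, zero_mul]

lemma ry_mul_ry_mul_ry_mul (r : RE6 K) : ry K * (ry K * (ry K * r)) = 0 := by
  rw [← mul_assoc (ry K) (ry K) r, ← mul_assoc, ry_mul_ry_mul_ry, zero_mul]

lemma ry_mul_ry_mul_rx_mul (r : RE6 K) : ry K * (ry K * (rx K * r)) =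
    (-1 : K) • (rx K * (ry K * (rx K * r)) + rx K * (ry K * (ry K * r))
      + ry K * (rx K * (ry K * r))) := by
  have h := congrArg (· * r) (ry_mul_ry_mul_rx (K := K))
  simpa only [add_mul, smul_mul_assoc, mul_assoc] using h

lemma ry_rx_ry_rx : ry K * (rx K * (ry K * rx K)) = rx K * (ry K * (rx K * ry K)) := by
  have h := ry_mul_ry_mul_rx_mul (rx K)
  simp only [rx_mul_rx, mul_zero, ry_mul_ry_mul_rx, mul_add, mul_smul_comm, rx_mul_rx_mul] at h
  rw [eq_comm, ← sub_eq_zero, h]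
  module

lemma ry_rx_ry_rx_mul (r : RE6 K) :
    ry K * (rx K * (ry K * (rx K * r))) = rx K * (ry K * (rx K * (ry K * r))) := by
  have h := congrArg (· * r) (ry_rx_ry_rx (K := K))
  simpa only [mul_assoc] using h

variable (K) in
/-- The powers of the radical of `R(E₆)`. -/
def radPow : ℕ → Submodule K (RE6 K)
  | 0 => ⊤
  | k + 1 => (radPow k).map (LinearMap.mulLeft K (rx K)) ⊔
      (radPow k).map (LinearMap.mulLeft K (ry K))

lemma mem_radPow_succ {k : ℕ} {z : RE6 K} :
    z ∈ radPow K (k + 1) ↔ ∃ p ∈ radPow K k, ∃ q ∈ radPow K k, rx K * p + ry K * q = z := by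
  simp [radPow, Submodule.mem_sup]

lemma rx_mul_mem {k : ℕ} {z : RE6 K} (hz : z ∈ radPow K k) : rx K * z ∈ radPow K (k + 1) :=
  mem_radPow_succ.2 ⟨z, hz, 0, zero_mem _, by simp⟩

lemma ry_mul_mem {k : ℕ} {z : RE6 K} (hz : z ∈ radPow K k) : ry K * z ∈ radPow K (k + 1) :=
  mem_radPow_succ.2 ⟨0, zero_mem _, z, hz, by simp⟩

lemma radPow_zero (z : RE6 K) : z ∈ radPow K 0 := Submodule.mem_top

lemma rx_mem : rx K ∈ radPow K 1 := by simpa using rx_mul_mem (radPow_zero (1 : RE6 K))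

lemma ry_mem : ry K ∈ radPow K 1 := by simpa using ry_mul_mem (radPow_zero (1 : RE6 K))

lemma radPow_succ_le (k : ℕ) : radPow K (k + 1) ≤ radPow K k := by
  induction k with
  | zero => exact le_top
  | succ k ih => exact sup_le_sup (Submodule.map_mono ih) (Submodule.map_mono ih)

lemma radPow_antitone : Antitone (radPow K) := antitone_nat_of_succ_le radPow_succ_le

/-- Every element of `R(E₆)` is a noncommutative polynomial in `x` and `y`. -/
lemma RE6.induction {C : RE6 K → Prop} (scalar : ∀ c, C (algebraMap K _ c)) (hx : C (rx K))
    (hy : C (ry K)) (add : ∀ a b, C a → C b → C (a + b)) (mul : ∀ a b, C a → C b → C (a * b))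
    (r : RE6 K) : C r := by
  obtain ⟨F, rfl⟩ := RingQuot.mkAlgHom_surjective K (RRel K) r
  induction F using FreeAlgebra.induction with
  | grade0 c => simpa using scalar c
  | grade1 i => fin_cases i <;> assumption
  | mul a b ha hb => simpa using mul _ _ ha hb
  | add a b ha hb => simpa using add _ _ ha hb

lemma mul_mem_radPow_right (r : RE6 K) {k : ℕ} {z : RE6 K} (hz : z ∈ radPow K k) :
    r * z ∈ radPow K k := by
  induction r using RE6.induction generalizing z with
  | scalar c => rw [← Algebra.smul_def]; exact Submodule.smul_mem _ _ hz
  | hx => exact radPow_succ_le k (rx_mul_mem hz)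
  | hy => exact radPow_succ_le k (ry_mul_mem hz)
  | add a b ha hb => rw [add_mul]; exact add_mem (ha hz) (hb hz)
  | mul a b ha hb => rw [mul_assoc]; exact ha (hb hz)

lemma mul_mem_radPow {i j : ℕ} {a b : RE6 K} (ha : a ∈ radPow K i) (hb : b ∈ radPow K j) :
    a * b ∈ radPow K (i + j) := by
  induction i generalizing a with
  | zero => simpa using mul_mem_radPow_right a hb
  | succ i ih =>
    obtain ⟨p, hp, q, hq, rfl⟩ := mem_radPow_succ.1 ha
    rw [add_mul, mul_assoc, mul_assoc, Nat.succ_add_eq_add_succ]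
    exact add_mem (rx_mul_mem (ih hp)) (ry_mul_mem (ih hq))

lemma pow_mem_radPow {a : RE6 K} (ha : a ∈ radPow K 1) (n : ℕ) : a ^ n ∈ radPow K n := by
  induction n with
  | zero => exact radPow_zero _
  | succ n ih => rw [pow_succ]; exact mul_mem_radPow ih ha

lemma radSq_le : radSq K ≤ radPow K 2 := by
  refine Submodule.span_le.2 ?_
  rintro z ⟨p, q, r, g, g', hg, hg', rfl⟩
  have hg1 : g ∈ radPow K 1 := by rcases hg with rfl | rfl; exacts [rx_mem, ry_mem]
  have hg1' : g' ∈ radPow K 1 := by rcases hg' with rfl | rfl; exacts [rx_mem, ry_mem]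
  exact mul_mem_radPow (mul_mem_radPow (mul_mem_radPow (mul_mem_radPow (radPow_zero p) hg1)
    (radPow_zero q)) hg1') (radPow_zero r)

lemma exists_scalar_sub_mem (r : RE6 K) : ∃ c : K, r - c • 1 ∈ radPow K 1 := by
  induction r using RE6.induction with
  | scalar c => exact ⟨c, by simp [Algebra.algebraMap_eq_smul_one]⟩
  | hx => exact ⟨0, by simpa using rx_mem⟩
  | hy => exact ⟨0, by simpa using ry_mem⟩
  | add a b ha hb =>
    obtain ⟨c, hc⟩ := ha
    obtain ⟨d, hd⟩ := hb
    refine ⟨c + d, ?_⟩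
    convert add_mem hc hd using 1
    module
  | mul a b ha hb =>
    obtain ⟨c, hc⟩ := ha
    obtain ⟨d, hd⟩ := hb
    refine ⟨c * d, ?_⟩
    convert add_mem (mul_mem_radPow_right a hd) (Submodule.smul_mem _ d hc) using 1
    simp only [mul_sub, mul_smul_comm, mul_one]
    module

lemma exists_mul_eq_of_mem_radPow_two {f : RE6 K} (hf : f ∈ radPow K 2) :
    ∃ a b c, f = rx K * (ry K * a) + ry K * (rx K * b) + ry K * (ry K * c) := by
  obtain ⟨p, hp, q, hq, rfl⟩ := mem_radPow_succ.1 hf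
  obtain ⟨a, -, b, -, rfl⟩ := mem_radPow_succ.1 hp
  obtain ⟨c, -, d, -, rfl⟩ := mem_radPow_succ.1 hq
  refine ⟨b, c, d, ?_⟩
  simp only [mul_add, rx_mul_rx_mul]
  abel

lemma exists_mul_eq_of_mem_radPow_three {f : RE6 K} (hf : f ∈ radPow K 3) :
    ∃ a b c, f = rx K * (ry K * (rx K * a)) + rx K * (ry K * (ry K * b))
      + ry K * (rx K * (ry K * c)) := by
  obtain ⟨p, hp, q, hq, rfl⟩ := mem_radPow_succ.1 hf
  obtain ⟨a, b, c, rfl⟩ := exists_mul_eq_of_mem_radPow_two hp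
  obtain ⟨a', b', c', rfl⟩ := exists_mul_eq_of_mem_radPow_two hq
  refine ⟨b - b', c - b', a' - b', ?_⟩
  simp only [mul_add, mul_sub, rx_mul_rx_mul, ry_mul_ry_mul_rx_mul, ry_mul_ry_mul_ry_mul]
  module

lemma exists_mul_eq_of_mem_radPow_four {f : RE6 K} (hf : f ∈ radPow K 4) :
    ∃ a b, f = rx K * (ry K * (rx K * (ry K * a))) + ry K * (rx K * (ry K * (ry K * b))) := by
  obtain ⟨p, hp, q, hq, rfl⟩ := mem_radPow_succ.1 hf
  obtain ⟨a, b, c, rfl⟩ := exists_mul_eq_of_mem_radPow_three hp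
  obtain ⟨a', b', c', rfl⟩ := exists_mul_eq_of_mem_radPow_three hq
  refine ⟨c + a' - c', b' - c', ?_⟩
  simp only [mul_add, mul_sub, rx_mul_rx_mul, ry_mul_ry_mul_rx_mul, ry_rx_ry_rx_mul,
    ry_mul_ry_mul_ry_mul, mul_zero]
  module

lemma exists_mul_eq_of_mem_radPow_five {f : RE6 K} (hf : f ∈ radPow K 5) :
    ∃ a, f = rx K * (ry K * (rx K * (ry K * (ry K * a)))) := by
  obtain ⟨p, hp, q, hq, rfl⟩ := mem_radPow_succ.1 hf
  obtain ⟨a, b, rfl⟩ := exists_mul_eq_of_mem_radPow_four hp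
  obtain ⟨a', b', rfl⟩ := exists_mul_eq_of_mem_radPow_four hq
  refine ⟨b + a' - b', ?_⟩
  simp only [mul_add, mul_sub, rx_mul_rx_mul, ry_mul_ry_mul_rx_mul, ry_rx_ry_rx_mul,
    ry_mul_ry_mul_ry_mul, mul_zero]
  module

lemma radPow_six : radPow K 6 = ⊥ := by
  refine (Submodule.eq_bot_iff _).2 fun f hf => ?_
  obtain ⟨p, hp, q, hq, rfl⟩ := mem_radPow_succ.1 hf
  obtain ⟨a, rfl⟩ := exists_mul_eq_of_mem_radPow_five hp
  obtain ⟨b, rfl⟩ := exists_mul_eq_of_mem_radPow_five hq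
  simp only [rx_mul_rx_mul, ry_rx_ry_rx_mul, ry_mul_ry_mul_ry_mul, mul_zero, add_zero]

lemma exists_eq_of_mem_radPow_two {f : RE6 K} (hf : f ∈ radPow K 2) :
    ∃ (a b c : K), ∃ r ∈ radPow K 3,
      f = a • (rx K * ry K) + b • (ry K * rx K) + c • (ry K * ry K) + r := by
  obtain ⟨p, q, r, rfl⟩ := exists_mul_eq_of_mem_radPow_two hf
  obtain ⟨a, ha⟩ := exists_scalar_sub_mem p
  obtain ⟨b, hb⟩ := exists_scalar_sub_mem q
  obtain ⟨c, hc⟩ := exists_scalar_sub_mem r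
  refine ⟨a, b, c, _, add_mem (add_mem (rx_mul_mem (ry_mul_mem ha)) (ry_mul_mem (rx_mul_mem hb)))
    (ry_mul_mem (ry_mul_mem hc)), ?_⟩
  simp only [mul_sub, mul_smul_comm, mul_one]
  module

lemma exists_eq_of_mem_radPow_three {f : RE6 K} (hf : f ∈ radPow K 3) :
    ∃ (a b c : K), ∃ r ∈ radPow K 4, f = a • (rx K * (ry K * rx K)) + b • (rx K * (ry K * ry K))
      + c • (ry K * (rx K * ry K)) + r := by
  obtain ⟨p, q, r, rfl⟩ := exists_mul_eq_of_mem_radPow_three hf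
  obtain ⟨a, ha⟩ := exists_scalar_sub_mem p
  obtain ⟨b, hb⟩ := exists_scalar_sub_mem q
  obtain ⟨c, hc⟩ := exists_scalar_sub_mem r
  refine ⟨a, b, c, _, add_mem (add_mem (rx_mul_mem (ry_mul_mem (rx_mul_mem ha)))
    (rx_mul_mem (ry_mul_mem (ry_mul_mem hb)))) (ry_mul_mem (rx_mul_mem (ry_mul_mem hc))), ?_⟩
  simp only [mul_sub, mul_smul_comm, mul_one]
  module

lemma exists_eq_of_mem_radPow_four {f : RE6 K} (hf : f ∈ radPow K 4) :
    ∃ (a b : K), ∃ r ∈ radPow K 5, f = a • (rx K * (ry K * (rx K * ry K)))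
      + b • (ry K * (rx K * (ry K * ry K))) + r := by
  obtain ⟨p, q, rfl⟩ := exists_mul_eq_of_mem_radPow_four hf
  obtain ⟨a, ha⟩ := exists_scalar_sub_mem p
  obtain ⟨b, hb⟩ := exists_scalar_sub_mem q
  refine ⟨a, b, _, add_mem (rx_mul_mem (ry_mul_mem (rx_mul_mem (ry_mul_mem ha))))
    (ry_mul_mem (rx_mul_mem (ry_mul_mem (ry_mul_mem hb)))), ?_⟩
  simp only [mul_sub, mul_smul_comm, mul_one]
  module

lemma exists_eq_of_mem_radPow_five {f : RE6 K} (hf : f ∈ radPow K 5) :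
    ∃ a : K, f = a • (rx K * (ry K * (rx K * (ry K * ry K)))) := by
  obtain ⟨p, rfl⟩ := exists_mul_eq_of_mem_radPow_five hf
  obtain ⟨a, ha⟩ := exists_scalar_sub_mem p
  have h := rx_mul_mem (ry_mul_mem (rx_mul_mem (ry_mul_mem (ry_mul_mem ha))))
  rw [radPow_six, Submodule.mem_bot] at h
  refine ⟨a, ?_⟩
  simpa only [mul_sub, mul_smul_comm, mul_one, sub_eq_zero] using h

/-- Left multiplication by `x` on `R(E₆)`, in the basis `1, x, y, xy, yx, yy, xyx, xyy, yxy, xyxy,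
yxyy, xyxyy`. -/
def leftMulX : (Fin 12 → K) →ₗ[K] (Fin 12 → K) where
  toFun v := ![0, v 0, 0, v 2, 0, 0, v 4, v 5, 0, v 8, 0, v 10]
  map_add' u v := by ext i; fin_cases i <;> simp
  map_smul' c v := by ext i; fin_cases i <;> simp

/-- Left multiplication by `y` on `R(E₆)`, in the same basis as `leftMulX`. -/
def leftMulY : (Fin 12 → K) →ₗ[K] (Fin 12 → K) where
  toFun v := ![0, 0, v 0, 0, v 1, v 2, -v 4, -v 4, v 3 - v 4, v 6 - v 8, v 7 - v 8, v 9 - v 10]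
  map_add' u v := by ext i; fin_cases i <;> simp <;> ring
  map_smul' c v := by ext i; fin_cases i <;> simp <;> ring

lemma leftMulX_mul_leftMulX : (leftMulX * leftMulX : Module.End K (Fin 12 → K)) = 0 := by
  refine LinearMap.ext fun v => funext fun i => ?_
  fin_cases i <;> simp [leftMulX]

lemma leftMulY_mul_leftMulY_mul_leftMulY :
    (leftMulY * (leftMulY * leftMulY) : Module.End K (Fin 12 → K)) = 0 := by
  refine LinearMap.ext fun v => funext fun i => ?_
  fin_cases i <;> simp [leftMulY]

lemma leftMulX_add_leftMulY_apply (v : Fin 12 → K) :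
    (leftMulX + leftMulY : Module.End K (Fin 12 → K)) v =
      ![0, v 0, v 0, v 2, v 1, v 2, 0, v 5 - v 4, v 3 - v 4, v 6, v 7 - v 8, v 9] := by
  funext i
  fin_cases i <;> simp [leftMulX, leftMulY] <;> ring

lemma leftMulX_add_leftMulY_pow_three :
    ((leftMulX + leftMulY : Module.End K (Fin 12 → K)) ^ 3) = 0 := by
  refine LinearMap.ext fun v => funext fun i => ?_
  rw [pow_succ, pow_two, Module.End.mul_apply, Module.End.mul_apply]
  simp only [leftMulX_add_leftMulY_apply]
  fin_cases i <;> simp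

/-- The left regular representation of `R(E₆)` in coordinates. -/
def regularRep : RE6 K →ₐ[K] Module.End K (Fin 12 → K) :=
  RingQuot.liftAlgHom K ⟨FreeAlgebra.lift K ![leftMulX, leftMulY], by
    rintro _ _ ⟨⟩
    · simpa using leftMulX_mul_leftMulX
    · simpa [mul_assoc] using leftMulY_mul_leftMulY_mul_leftMulY
    · simpa using leftMulX_add_leftMulY_pow_three⟩

lemma rx_ry_rx_ry_ry_ne_zero : rx K * (ry K * (rx K * (ry K * ry K))) ≠ 0 := by
  intro h
  have h1 := congrFun (congrArg (fun r => regularRep r (Pi.single 0 1)) h) 11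
  simp [regularRep, rx, ry, leftMulX, leftMulY] at h1

lemma add_pow_three_expand (a b : RE6 K) :
    (a + b) ^ 3 = a ^ 3 + (a * (a * b) + a * (b * a) + b * (a * a))
      + (a * (b * b) + b * (a * b) + b * (b * a) + b * (b * b)) := by
  noncomm_ring

lemma mul_sub_mul_eq {R : Type*} [Ring R] (a a' b b' : R) :
    a * b - a' * b' = a * (b - b') + (a - a') * b' := by
  noncomm_ring

lemma mul_sub_mul_mem_radPow {i j : ℕ} {a a' b b' : RE6 K} (ha : a ∈ radPow K i)
    (hb' : b' ∈ radPow K j) (haa' : a - a' ∈ radPow K (i + 1)) (hbb' : b - b' ∈ radPow K (j + 1)) :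
    a * b - a' * b' ∈ radPow K (i + j + 1) := by
  rw [mul_sub_mul_eq]
  refine add_mem (mul_mem_radPow (j := j + 1) ha hbb') ?_
  rw [add_right_comm]
  exact mul_mem_radPow haa' hb'

lemma mem_radPow_of_sub_mem {i : ℕ} {a a' : RE6 K} (ha : a ∈ radPow K i)
    (h : a - a' ∈ radPow K (i + 1)) : a' ∈ radPow K i := by
  simpa using sub_mem ha (radPow_succ_le i h)

/-- The leading term of `(w' + f')³ = 0` when `w'³ = 0`. -/
lemma leading_term_mem_radPow {k : ℕ} (hk : 2 ≤ k) {w w' f f' : RE6 K} (hw : w ∈ radPow K 1)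
    (hww' : w - w' ∈ radPow K 2) (hf : f ∈ radPow K k) (hff' : f - f' ∈ radPow K (k + 1))
    (hw3 : w' ^ 3 = 0) (h : (w' + f') ^ 3 = 0) :
    w * (w * f) + w * (f * w) + f * (w * w) ∈ radPow K (k + 3) := by
  have hw' := mem_radPow_of_sub_mem hw hww'
  have hf' := mem_radPow_of_sub_mem hf hff'
  have hffw : f' * (f' * w') ∈ radPow K (k + 3) :=
    radPow_antitone (by omega) (mul_mem_radPow hf' (mul_mem_radPow hf' hw'))
  have hfwf : f' * (w' * f') ∈ radPow K (k + 3) :=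
    radPow_antitone (by omega) (mul_mem_radPow hf' (mul_mem_radPow hw' hf'))
  have hwff : w' * (f' * f') ∈ radPow K (k + 3) :=
    radPow_antitone (by omega) (mul_mem_radPow hw' (mul_mem_radPow hf' hf'))
  have hfff : f' * (f' * f') ∈ radPow K (k + 3) :=
    radPow_antitone (by omega) (mul_mem_radPow hf' (mul_mem_radPow hf' hf'))
  have hwwf : w * (w * f) - w' * (w' * f') ∈ radPow K (k + 3) :=
    radPow_antitone (by omega) (mul_sub_mul_mem_radPow hw (mul_mem_radPow hw' hf') hww'
      (mul_sub_mul_mem_radPow hw hf' hww' hff'))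
  have hwfw : w * (f * w) - w' * (f' * w') ∈ radPow K (k + 3) :=
    radPow_antitone (by omega) (mul_sub_mul_mem_radPow hw (mul_mem_radPow hf' hw') hww'
      (mul_sub_mul_mem_radPow hf hw' hff' hww'))
  have hfww : f * (w * w) - f' * (w' * w') ∈ radPow K (k + 3) :=
    radPow_antitone (by omega) (mul_sub_mul_mem_radPow hf (mul_mem_radPow hw' hw') hff'
      (mul_sub_mul_mem_radPow hw hw' hww' hww'))
  rw [add_pow_three_expand, hw3, zero_add] at h
  have hlead := neg_mem (add_mem (add_mem (add_mem hwff hfwf) hffw) hfff)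
  rw [← eq_neg_iff_add_eq_zero.2 h] at hlead
  convert add_mem hlead (add_mem (add_mem hwwf hwfw) hfww) using 1
  abel

/-- The constraint on the component of degree two of an admissible element. -/
lemma coeff_eq_of_admissible_two {a b c : K} {r : RE6 K} (hr : r ∈ radPow K 3)
    (h : (rx K + ry K + (a • (rx K * ry K) + b • (ry K * rx K) + c • (ry K * ry K) + r)) ^ 3 = 0) :
    a + b = 2 * c := by
  have hw : rx K + ry K ∈ radPow K 1 := add_mem rx_mem ry_mem
  set f₂ := a • (rx K * ry K) + b • (ry K * rx K) + c • (ry K * ry K) with hf₂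
  have hf : f₂ ∈ radPow K 2 := add_mem (add_mem
    (Submodule.smul_mem _ _ (mul_mem_radPow rx_mem ry_mem))
    (Submodule.smul_mem _ _ (mul_mem_radPow ry_mem rx_mem)))
    (Submodule.smul_mem _ _ (mul_mem_radPow ry_mem ry_mem))
  set w := rx K + ry K with hw'
  have key : ry K * (w * (w * f₂) + w * (f₂ * w) + f₂ * (w * w)) = 0 := by
    rw [← Submodule.mem_bot K, ← radPow_six]
    exact ry_mul_mem (leading_term_mem_radPow le_rfl hw (by rw [sub_self]; exact zero_mem _) hf (by simpa using hr)
      rx_add_ry_pow_three h)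
  have : (a + b - 2 * c) • (rx K * (ry K * (rx K * (ry K * ry K)))) = 0 := by
    rw [← key, hf₂, hw']
    simp only [mul_add, add_mul, mul_smul_comm, smul_mul_assoc, mul_assoc, rx_mul_rx,
      rx_mul_rx_mul, ry_mul_ry_mul_rx, ry_mul_ry_mul_rx_mul, ry_mul_ry_mul_ry, ry_rx_ry_rx,
      ry_rx_ry_rx_mul, mul_zero]
    module
  simpa [rx_ry_rx_ry_ry_ne_zero, sub_eq_zero] using this

lemma add_smul_sq_pow_three (t : K) : (rx K + ry K + t • (rx K + ry K) ^ 2) ^ 3 = 0 := by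
  have h : rx K + ry K + t • (rx K + ry K) ^ 2 = (1 + t • (rx K + ry K)) * (rx K + ry K) := by
    rw [add_mul, one_mul, smul_mul_assoc, pow_two]
  have hc : Commute (1 + t • (rx K + ry K)) (rx K + ry K) :=
    (Commute.one_left _).add_left ((Commute.refl _).smul_left t)
  rw [h, hc.mul_pow, rx_add_ry_pow_three, mul_zero]

/-- The constraint on the component of degree three of a perturbation of `x + y + t (x + y)²`. -/
lemma coeff_eq_of_admissible_three {t a b c : K} {r : RE6 K} (hr : r ∈ radPow K 4)
    (h : (rx K + ry K + t • (rx K + ry K) ^ 2 + (a • (rx K * (ry K * rx K))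
      + b • (rx K * (ry K * ry K)) + c • (ry K * (rx K * ry K)) + r)) ^ 3 = 0) :
    c = 2 * b - 3 * a := by
  have hw : rx K + ry K ∈ radPow K 1 := add_mem rx_mem ry_mem
  have hw2 : (rx K + ry K) ^ 2 ∈ radPow K 2 := pow_mem_radPow hw 2
  have hw3 := add_smul_sq_pow_three (K := K) t
  set w := rx K + ry K with hw'
  set f := a • (rx K * (ry K * rx K)) + b • (rx K * (ry K * ry K))
    + c • (ry K * (rx K * ry K)) with hf'
  have hf : f ∈ radPow K 3 := add_mem (add_mem
    (Submodule.smul_mem _ _ (mul_mem_radPow rx_mem (mul_mem_radPow ry_mem rx_mem)))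
    (Submodule.smul_mem _ _ (mul_mem_radPow rx_mem (mul_mem_radPow ry_mem ry_mem))))
    (Submodule.smul_mem _ _ (mul_mem_radPow ry_mem (mul_mem_radPow rx_mem ry_mem)))
  have key : w * (w * f) + w * (f * w) + f * (w * w) = 0 := by
    rw [← Submodule.mem_bot K, ← radPow_six]
    exact leading_term_mem_radPow (by norm_num) hw (by simpa using Submodule.smul_mem _ t hw2) hf
      (by simpa using hr) hw3 h
  have : (c - (2 * b - 3 * a)) • (rx K * (ry K * (rx K * (ry K * ry K)))) = 0 := by
    rw [← key, hf', hw']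
    simp only [mul_add, add_mul, mul_smul_comm, smul_mul_assoc, mul_assoc, rx_mul_rx,
      rx_mul_rx_mul, ry_mul_ry_mul_rx, ry_mul_ry_mul_rx_mul, ry_mul_ry_mul_ry, ry_rx_ry_rx,
      ry_rx_ry_rx_mul, mul_zero]
    module
  simpa [rx_ry_rx_ry_ry_ne_zero, sub_eq_zero] using this

lemma exists_sub_mem_of_admissible {f : RE6 K} (hf : f ∈ radPow K 2)
    (h : (rx K + ry K + f) ^ 3 = 0) :
    ∃ t : K, ∃ g ∈ radPow K 1, f - t • (rx K + ry K) ^ 2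
      + ((rx K + ry K) * g - g * (rx K + ry K)) ∈ radPow K 3 := by
  obtain ⟨a, b, c, r, hr, rfl⟩ := exists_eq_of_mem_radPow_two hf
  obtain rfl : a = 2 * c - b := eq_sub_of_add_eq (coeff_eq_of_admissible_two hr h)
  refine ⟨c, (b - c) • ry K, Submodule.smul_mem _ _ ry_mem, ?_⟩
  convert hr using 1
  simp only [pow_two, mul_add, add_mul, mul_smul_comm, smul_mul_assoc, rx_mul_rx]
  module

lemma exists_add_mem_of_radPow_three {f : RE6 K} (hf : f ∈ radPow K 3) {t : K}
    (h : (rx K + ry K + t • (rx K + ry K) ^ 2 + f) ^ 3 = 0) :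
    ∃ g ∈ radPow K 2, f + ((rx K + ry K) * g - g * (rx K + ry K)) ∈ radPow K 4 := by
  obtain ⟨a, b, c, r, hr, rfl⟩ := exists_eq_of_mem_radPow_three hf
  obtain rfl := coeff_eq_of_admissible_three hr h
  refine ⟨(2 * a - b) • (rx K * ry K) + (a - b) • (ry K * ry K),
    add_mem (Submodule.smul_mem _ _ (mul_mem_radPow rx_mem ry_mem))
    (Submodule.smul_mem _ _ (mul_mem_radPow ry_mem ry_mem)), ?_⟩
  convert hr using 1
  simp only [mul_add, add_mul, mul_smul_comm, smul_mul_assoc, mul_assoc, rx_mul_rx_mul,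
    ry_mul_ry_mul_rx, ry_mul_ry_mul_ry]
  module

lemma exists_add_mem_of_radPow_four {f : RE6 K} (hf : f ∈ radPow K 4) :
    ∃ g ∈ radPow K 3, f + ((rx K + ry K) * g - g * (rx K + ry K)) ∈ radPow K 5 := by
  obtain ⟨a, b, r, hr, rfl⟩ := exists_eq_of_mem_radPow_four hf
  refine ⟨(b - 2 * a) • (rx K * (ry K * ry K)) + (b - a) • (ry K * (rx K * ry K)), add_mem
    (Submodule.smul_mem _ _ (mul_mem_radPow rx_mem (mul_mem_radPow ry_mem ry_mem)))
    (Submodule.smul_mem _ _ (mul_mem_radPow ry_mem (mul_mem_radPow rx_mem ry_mem))), ?_⟩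
  convert hr using 1
  simp only [mul_add, add_mul, mul_smul_comm, smul_mul_assoc, mul_assoc, rx_mul_rx_mul,
    ry_mul_ry_mul_rx, ry_mul_ry_mul_rx_mul, ry_mul_ry_mul_ry, ry_rx_ry_rx, mul_zero]
  module

lemma exists_add_mem_of_radPow_five {f : RE6 K} (hf : f ∈ radPow K 5) :
    ∃ g ∈ radPow K 4, f + ((rx K + ry K) * g - g * (rx K + ry K)) ∈ radPow K 6 := by
  obtain ⟨a, rfl⟩ := exists_eq_of_mem_radPow_five hf
  refine ⟨(-a) • (ry K * (rx K * (ry K * ry K))), Submodule.smul_mem _ _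
    (mul_mem_radPow ry_mem (mul_mem_radPow rx_mem (mul_mem_radPow ry_mem ry_mem))), ?_⟩
  convert zero_mem (radPow K 6) using 1
  simp only [mul_add, add_mul, mul_smul_comm, smul_mul_assoc, mul_assoc, rx_mul_rx_mul,
    ry_mul_ry_mul_rx, ry_mul_ry_mul_rx_mul, ry_mul_ry_mul_ry, ry_rx_ry_rx_mul, mul_zero]
  module

lemma isNilpotent_of_mem_radPow {g : RE6 K} (hg : g ∈ radPow K 1) : IsNilpotent g :=
  ⟨6, by simpa [radPow_six] using pow_mem_radPow hg 6⟩

lemma exists_conj_eq {k : ℕ} {w v f g : RE6 K} (hv : v ∈ radPow K 2)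
    (hf : f ∈ radPow K (k + 2)) (hg : g ∈ radPow K (k + 1))
    (hfg : f + (w * g - g * w) ∈ radPow K (k + 3)) :
    ∃ u : (RE6 K)ˣ, ∃ f' ∈ radPow K (k + 3), (w + v + f) * u = u * (w + v + f') := by
  obtain ⟨u, hu⟩ :=
    (isNilpotent_of_mem_radPow (radPow_antitone (by omega) hg)).isUnit_one_add
  have hfg' : f * g ∈ radPow K (k + 3) := radPow_antitone (by omega) (mul_mem_radPow hf hg)
  have hvg : v * g - g * v ∈ radPow K (k + 3) :=
    sub_mem (radPow_antitone (by omega) (mul_mem_radPow hv hg))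
      (radPow_antitone (by omega) (mul_mem_radPow hg hv))
  refine ⟨u, ↑u⁻¹ * (f + (w * g - g * w) + (v * g - g * v) + f * g),
    mul_mem_radPow_right _ (add_mem (add_mem hfg hvg) hfg'), ?_⟩
  rw [mul_add, Units.mul_inv_cancel_left, hu]
  noncomm_ring

lemma pow_eq_zero_of_mul_unit_eq {a b : RE6 K} {u : (RE6 K)ˣ} (h : a * u = u * b) {n : ℕ}
    (ha : a ^ n = 0) : b ^ n = 0 := by
  have hs : SemiconjBy (u : RE6 K) b a := h.symm
  have := (hs.pow_right n).eq
  rwa [ha, zero_mul, Units.mul_right_eq_zero] at this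

/-- An admissible deformation of `x + y` is conjugate to `x + y + t (x + y)²`. -/
theorem exists_conj_of_admissible {f : RE6 K} (hf : f ∈ radPow K 2)
    (h : (rx K + ry K + f) ^ 3 = 0) :
    ∃ (t : K) (u : (RE6 K)ˣ),
      (rx K + ry K + f) * u = u * (rx K + ry K + t • (rx K + ry K) ^ 2) := by
  obtain ⟨t, g, hg, hfg⟩ := exists_sub_mem_of_admissible hf h
  have hv : t • (rx K + ry K) ^ 2 ∈ radPow K 2 :=
    Submodule.smul_mem _ _ (pow_mem_radPow (add_mem rx_mem ry_mem) 2)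
  obtain ⟨u₂, f₃, hf₃, h₃⟩ := exists_conj_eq (k := 0) hv (sub_mem hf hv) hg hfg
  rw [add_add_sub_cancel] at h₃
  obtain ⟨g, hg, hfg⟩ := exists_add_mem_of_radPow_three hf₃ (pow_eq_zero_of_mul_unit_eq h₃ h)
  obtain ⟨u₃, f₄, hf₄, h₄⟩ := exists_conj_eq (k := 1) hv hf₃ hg hfg
  obtain ⟨g, hg, hfg⟩ := exists_add_mem_of_radPow_four hf₄
  obtain ⟨u₄, f₅, hf₅, h₅⟩ := exists_conj_eq (k := 2) hv hf₄ hg hfg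
  obtain ⟨g, hg, hfg⟩ := exists_add_mem_of_radPow_five hf₅
  obtain ⟨u₅, f₆, hf₆, h₆⟩ := exists_conj_eq (k := 3) hv hf₅ hg hfg
  obtain rfl : f₆ = 0 := by simpa [radPow_six] using hf₆
  refine ⟨t, u₂ * u₃ * u₄ * u₅, ?_⟩
  rw [add_zero] at h₆
  simp only [Units.val_mul]
  simp only [← mul_assoc]
  rw [h₃, mul_assoc _ _ (u₃ : RE6 K), h₄, ← mul_assoc, mul_assoc _ _ (u₄ : RE6 K), h₅,
    ← mul_assoc, mul_assoc _ _ (u₅ : RE6 K), h₆, ← mul_assoc]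

lemma inverse_one_add_smul {K R : Type*} [Field K] [Ring R] [Algebra K R] {w : R}
    (hw : w ^ 3 = 0) (t : K) :
    (1 + (-t) • (w + t • w ^ 2) + (2 * t ^ 2) • (w + t • w ^ 2) ^ 2) * (1 + t • w) = 1 := by
  have h3 : w * (w * w) = 0 := by rw [← hw]; noncomm_ring
  simp only [pow_two, mul_add, add_mul, mul_one, one_mul, mul_smul_comm, smul_mul_assoc,
    mul_assoc, h3, mul_zero, smul_zero, add_zero]
  module

theorem exists_units_of_admissible {f : RE6 K} (hf : f ∈ radPow K 2)
    (h : (rx K + ry K + f) ^ 3 = 0) :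
    ∃ (α β : (RE6 K)ˣ) (t c d : K), ↑α * (rx K + ry K) * ↑β = rx K + ry K + f ∧
      (β * α : RE6 K) = 1 + t • (rx K + ry K) + (0 : K) • (rx K + ry K) ^ 2 ∧
      (↑β⁻¹ * ↑α⁻¹ : RE6 K) = 1 + c • (rx K + ry K + f) + d • (rx K + ry K + f) ^ 2 := by
  obtain ⟨t, u, hu⟩ := exists_conj_of_admissible hf h
  have hw3 := rx_add_ry_pow_three (K := K)
  have hw : rx K + ry K ∈ radPow K 1 := add_mem rx_mem ry_mem
  set w := rx K + ry K
  set m := w + f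
  obtain ⟨v, hv⟩ :=
    (isNilpotent_of_mem_radPow (Submodule.smul_mem _ t hw)).isUnit_one_add
  have hvw : (v : RE6 K) * w = w + t • w ^ 2 := by
    rw [hv, add_mul, one_mul, smul_mul_assoc, pow_two]
  refine ⟨u * v, u⁻¹, t, -t, 2 * t ^ 2, ?_, ?_, ?_⟩
  · rw [Units.val_mul, mul_assoc (u : RE6 K), hvw, ← hu, Units.mul_inv_cancel_right]
  · rw [Units.val_mul, Units.inv_mul_cancel_left, hv, zero_smul, add_zero]
  · have hm2 : m ^ 2 * u = u * (w + t • w ^ 2) ^ 2 :=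
      (SemiconjBy.pow_right (show SemiconjBy (u : RE6 K) _ _ from hu.symm) 2).eq.symm
    have hinv : (1 + (-t) • (w + t • w ^ 2) + (2 * t ^ 2) • (w + t • w ^ 2) ^ 2) * v = 1 := by
      rw [hv]
      exact inverse_one_add_smul hw3 t
    have huv : (1 + (-t) • m + (2 * t ^ 2) • m ^ 2) * (u * v : RE6 K) = u := by
      rw [← mul_assoc]
      simp only [add_mul _ _ (u : RE6 K), smul_mul_assoc, one_mul, hu, hm2]
      rw [← mul_smul_comm, ← mul_smul_comm, ← mul_one_add, ← mul_add, mul_assoc, hinv, mul_one]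
    rw [inv_inv]
    exact ((Units.eq_mul_inv_iff_mul_eq _).2 huv).symm

end RadicalFiltration

section Twist

variable {K} {T : Type*} [Ring T] [Algebra K T]

/-- The relations shared by the preprojective algebra of type `E₆` and its deformations. -/
structure IsE6System (g : E6Gen → T) : Prop where
  idem (v w : Fin 6) : g (.e v) * g (.e w) = if v = w then g (.e v) else 0
  sum_idem : ∑ v, g (.e v) = 1
  srcA (i : Fin 5) : g (.e (asrc i)) * g (.a i) = g (.a i)
  tgtA (i : Fin 5) : g (.a i) * g (.e (atgt i)) = g (.a i)
  srcAb (i : Fin 5) : g (.e (atgt i)) * g (.abar i) = g (.abar i)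
  tgtAb (i : Fin 5) : g (.abar i) * g (.e (asrc i)) = g (.abar i)
  pre0 : g (.a 0) * g (.abar 0) = 0
  pre1 : g (.a 1) * g (.abar 1) = 0
  pre2 : g (.abar 1) * g (.a 1) + g (.a 2) * g (.abar 2) = 0
  pre4 : g (.abar 3) * g (.a 3) + g (.a 4) * g (.abar 4) = 0
  pre5 : g (.abar 4) * g (.a 4) = 0
  cube : (g (.abar 0) * g (.a 0) + g (.abar 2) * g (.a 2)) ^ 3 = 0

lemma sq_eq_zero_of_add_eq_zero {p q r s : T} (h : p * q + r * s = 0) (hsr : s * r = 0) :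
    p * q * (p * q) = 0 := by
  rw [eq_neg_of_add_eq_zero_left h, neg_mul_neg, mul_assoc, ← mul_assoc s, hsr, zero_mul,
    mul_zero]

lemma mul_cube_eq_zero {p q : T} (h : p * q * (p * q) = 0) : q * p * (q * p) * (q * p) = 0 := by
  have h' : q * p * (q * p) * (q * p) = q * (p * q * (p * q)) * p := by noncomm_ring
  rw [h', h, mul_zero, zero_mul]

lemma pow_three_eq_zero_of_add_eq_zero {p q : T} (h : p + q = 0) (hq : q * q * q = 0) :
    p ^ 3 = 0 := by
  rw [eq_neg_of_add_eq_zero_left h, Odd.neg_pow (by decide), pow_succ, pow_two, hq, neg_zero]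

lemma add_neg_add_eq_zero (p q : T) : p + -(p + q) + q = 0 := by
  rw [add_right_comm, add_neg_cancel]

lemma commute_mul_of_mul_eq {e p q : T} (hp : e * p = p) (hq : q * e = q) :
    Commute e (p * q) := by
  rw [Commute, SemiconjBy, ← mul_assoc, hp, mul_assoc, hq]

namespace IsE6System

variable {g : E6Gen → T} (hg : IsE6System g)

include hg in
lemma loop_two_sq : g (.a 2) * g (.abar 2) * (g (.a 2) * g (.abar 2)) = 0 :=
  sq_eq_zero_of_add_eq_zero ((add_comm _ _).trans hg.pre2) hg.pre1

include hg in
lemma loop_three_sq : g (.abar 3) * g (.a 3) * (g (.abar 3) * g (.a 3)) = 0 :=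
  sq_eq_zero_of_add_eq_zero hg.pre4 hg.pre5

variable (K) in
/-- The action of `R(E₆)` by the loops `ā₀a₀` and `ā₂a₂` at the vertex `3`. -/
def loopHom : RE6 K →ₐ[K] T :=
  RingQuot.liftAlgHom K
    ⟨FreeAlgebra.lift K ![g (.abar 0) * g (.a 0), g (.abar 2) * g (.a 2)], by
      rintro _ _ ⟨⟩
      · simp [mul_assoc, ← mul_assoc (g (.a 0)), hg.pre0]
      · simpa using mul_cube_eq_zero hg.loop_two_sq
      · simpa using hg.cube⟩

@[simp] lemma loopHom_rx : hg.loopHom K (rx K) = g (.abar 0) * g (.a 0) := by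
  simp [loopHom, rx]

@[simp] lemma loopHom_ry : hg.loopHom K (ry K) = g (.abar 2) * g (.a 2) := by
  simp [loopHom, ry]

lemma loopHom_mk (F : FreeAlgebra K (Fin 2)) :
    hg.loopHom K (RingQuot.mkAlgHom K (RRel K) F) = FreeAlgebra.lift K g (subst K F) := by
  have h : (hg.loopHom K).comp (RingQuot.mkAlgHom K (RRel K)) =
      (FreeAlgebra.lift K g).comp (subst K) := by
    ext i
    fin_cases i <;> simp [loopHom, subst, aF, abF]
  exact DFunLike.congr_fun h F

lemma commute_loopHom (r : RE6 K) : Commute (g (.e 3)) (hg.loopHom K r) := by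
  induction r using RE6.induction with
  | scalar c => rw [AlgHom.commutes]; exact (Algebra.commutes c _).symm
  | hx => rw [loopHom_rx]; exact commute_mul_of_mul_eq (hg.srcAb 0) (hg.tgtA 0)
  | hy => rw [loopHom_ry]; exact commute_mul_of_mul_eq (hg.srcAb 2) (hg.tgtA 2)
  | add a b ha hb => rw [map_add]; exact ha.add_right hb
  | mul a b ha hb => rw [map_mul]; exact ha.mul_right hb

lemma loop_three_insert {m : RE6 K} (hm : hg.loopHom K m + g (.a 3) * g (.abar 3) = 0) (c d : K) :
    g (.abar 3) * hg.loopHom K (1 + c • m + d • m ^ 2) * g (.a 3) = g (.abar 3) * g (.a 3) := by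
  have h := hg.loop_three_sq
  rw [map_add, map_add, map_smul, map_smul, map_pow, map_one, eq_neg_of_add_eq_zero_left hm]
  have h1 : g (.abar 3) * (g (.a 3) * (g (.abar 3) * g (.a 3))) = 0 := by rw [← h]; noncomm_ring
  simp [pow_two, mul_add, add_mul, mul_assoc, h1]

end IsE6System

/-- Multiply `a₃` by `p` on the left and `ā₃` by `q` on the right. -/
def twistGen (g : E6Gen → T) (p q : T) : E6Gen → T
  | .e v => g (.e v)
  | .a i => if i = 3 then p * g (.a i) else g (.a i)
  | .abar i => if i = 3 then g (.abar i) * q else g (.abar i)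

namespace IsE6System

variable {g : E6Gen → T} (hg : IsE6System g)

lemma twist {α β : RE6 K}
    (h : g (.abar 3) * hg.loopHom K (β * α) * g (.a 3) = g (.abar 3) * g (.a 3)) :
    IsE6System (twistGen g (hg.loopHom K α) (hg.loopHom K β)) where
  idem := hg.idem
  sum_idem := hg.sum_idem
  srcA i := by
    by_cases hi : i = 3
    · subst hi
      change g (.e 3) * (hg.loopHom K α * g (.a 3)) = hg.loopHom K α * g (.a 3)
      rw [← mul_assoc, (hg.commute_loopHom α).eq, mul_assoc]
      exact congrArg _ (hg.srcA 3)
    · simpa [twistGen, hi] using hg.srcA i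
  tgtA i := by
    by_cases hi : i = 3
    · subst hi
      simp [twistGen, mul_assoc, hg.tgtA 3]
    · simpa [twistGen, hi] using hg.tgtA i
  srcAb i := by
    by_cases hi : i = 3
    · subst hi
      simp [twistGen, ← mul_assoc, hg.srcAb 3]
    · simpa [twistGen, hi] using hg.srcAb i
  tgtAb i := by
    by_cases hi : i = 3
    · subst hi
      change g (.abar 3) * hg.loopHom K β * g (.e 3) = g (.abar 3) * hg.loopHom K β
      rw [mul_assoc, ← (hg.commute_loopHom β).eq, ← mul_assoc]
      exact congrArg (· * _) (hg.tgtAb 3)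
    · simpa [twistGen, hi] using hg.tgtAb i
  pre0 := hg.pre0
  pre1 := hg.pre1
  pre2 := hg.pre2
  pre4 := by
    have := hg.pre4
    rw [← h, map_mul] at this
    simpa [twistGen, mul_assoc] using this
  pre5 := hg.pre5
  cube := hg.cube

lemma twist_loop_three {α β m m' : RE6 K} (hm : hg.loopHom K m + g (.a 3) * g (.abar 3) = 0)
    (h : α * m * β = m') :
    twistGen g (hg.loopHom K α) (hg.loopHom K β) (.a 3) *
      twistGen g (hg.loopHom K α) (hg.loopHom K β) (.abar 3) = -hg.loopHom K m' := by
  have : twistGen g (hg.loopHom K α) (hg.loopHom K β) (.a 3) *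
      twistGen g (hg.loopHom K α) (hg.loopHom K β) (.abar 3) =
      hg.loopHom K α * (g (.a 3) * g (.abar 3)) * hg.loopHom K β := by
    simp [twistGen, mul_assoc]
  rw [this, ← h, eq_neg_of_add_eq_zero_right hm]
  simp

lemma lift_twistGen_subst (p q : T) (F : FreeAlgebra K (Fin 2)) :
    FreeAlgebra.lift K (twistGen g p q) (subst K F) =
      hg.loopHom K (RingQuot.mkAlgHom K (RRel K) F) := by
  have h : (FreeAlgebra.lift K (twistGen g p q)).comp (subst K) =
      (FreeAlgebra.lift K g).comp (subst K) := by
    ext i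
    fin_cases i <;> simp [twistGen, subst, aF, abF]
  rw [hg.loopHom_mk]
  exact DFunLike.congr_fun h F

/-- The homomorphism from the preprojective algebra determined by a system of elements. -/
def liftP (h : g (.abar 0) * g (.a 0) + g (.abar 2) * g (.a 2) + g (.a 3) * g (.abar 3) = 0) :
    PE6 K →ₐ[K] T :=
  RingQuot.liftAlgHom K ⟨FreeAlgebra.lift K g, by
    intro p q hpq
    cases hpq with
    | idem v w => simpa [eF, apply_ite] using hg.idem v w
    | sum_idem => simpa [eF] using hg.sum_idem
    | srcA i => simpa [eF, aF] using hg.srcA i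
    | tgtA i => simpa [eF, aF] using hg.tgtA i
    | srcAb i => simpa [eF, abF] using hg.srcAb i
    | tgtAb i => simpa [eF, abF] using hg.tgtAb i
    | pre0 => simpa [aF, abF] using hg.pre0
    | pre1 => simpa [aF, abF] using hg.pre1
    | pre2 => simpa [aF, abF] using hg.pre2
    | pre3 => simpa [aF, abF] using h
    | pre4 => simpa [aF, abF] using hg.pre4
    | pre5 => simpa [aF, abF] using hg.pre5⟩

@[simp] lemma liftP_mk (h) (i : E6Gen) :
    (hg.liftP h : PE6 K →ₐ[K] T) (RingQuot.mkAlgHom K (PRel K) (ι K i)) = g i := by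
  simp [liftP]

/-- The homomorphism from a deformed preprojective algebra determined by a system of elements. -/
def liftD {F : FreeAlgebra K (Fin 2)} (h : g (.abar 0) * g (.a 0) + g (.abar 2) * g (.a 2)
    + g (.a 3) * g (.abar 3) + FreeAlgebra.lift K g (subst K F) = 0) :
    PfE6 K F →ₐ[K] T :=
  RingQuot.liftAlgHom K ⟨FreeAlgebra.lift K g, by
    intro p q hpq
    cases hpq with
    | idem v w => simpa [eF, apply_ite] using hg.idem v w
    | sum_idem => simpa [eF] using hg.sum_idem
    | srcA i => simpa [eF, aF] using hg.srcA i
    | tgtA i => simpa [eF, aF] using hg.tgtA i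
    | srcAb i => simpa [eF, abF] using hg.srcAb i
    | tgtAb i => simpa [eF, abF] using hg.tgtAb i
    | pre0 => simpa [aF, abF] using hg.pre0
    | pre1 => simpa [aF, abF] using hg.pre1
    | pre2 => simpa [aF, abF] using hg.pre2
    | pre3 => simpa [aF, abF] using h
    | pre4 => simpa [aF, abF] using hg.pre4
    | pre5 => simpa [aF, abF] using hg.pre5
    | cube => simpa [aF, abF] using hg.cube⟩

@[simp] lemma liftD_mk {F : FreeAlgebra K (Fin 2)} (h) (i : E6Gen) :
    (hg.liftD h : PfE6 K F →ₐ[K] T) (RingQuot.mkAlgHom K (DRel K F) (ι K i)) = g i := by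
  simp [liftD]

end IsE6System

variable (K) in
/-- The images of the generators in `P(E₆)`. -/
def genP (i : E6Gen) : PE6 K := RingQuot.mkAlgHom K (PRel K) (ι K i)

variable (K) in
/-- The images of the generators in the deformed preprojective algebra. -/
def genD (F : FreeAlgebra K (Fin 2)) (i : E6Gen) : PfE6 K F :=
  RingQuot.mkAlgHom K (DRel K F) (ι K i)

lemma genP_pre3 : genP K (.abar 0) * genP K (.a 0) + genP K (.abar 2) * genP K (.a 2)
    + genP K (.a 3) * genP K (.abar 3) = 0 := by
  simpa [genP, aF, abF] using RingQuot.mkAlgHom_rel K (PRel.pre3 (K := K))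

lemma genP_pre4 :
    genP K (.abar 3) * genP K (.a 3) + genP K (.a 4) * genP K (.abar 4) = 0 := by
  simpa [genP, aF, abF] using RingQuot.mkAlgHom_rel K (PRel.pre4 (K := K))

lemma genP_pre5 : genP K (.abar 4) * genP K (.a 4) = 0 := by
  simpa [genP, aF, abF] using RingQuot.mkAlgHom_rel K (PRel.pre5 (K := K))

lemma isE6System_genP : IsE6System (genP K) where
  idem v w := by
    simpa [genP, eF, apply_ite] using RingQuot.mkAlgHom_rel K (PRel.idem (K := K) v w)
  sum_idem := by simpa [genP, eF] using RingQuot.mkAlgHom_rel K (PRel.sum_idem (K := K))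
  srcA i := by simpa [genP, eF, aF] using RingQuot.mkAlgHom_rel K (PRel.srcA (K := K) i)
  tgtA i := by simpa [genP, eF, aF] using RingQuot.mkAlgHom_rel K (PRel.tgtA (K := K) i)
  srcAb i := by simpa [genP, eF, abF] using RingQuot.mkAlgHom_rel K (PRel.srcAb (K := K) i)
  tgtAb i := by simpa [genP, eF, abF] using RingQuot.mkAlgHom_rel K (PRel.tgtAb (K := K) i)
  pre0 := by simpa [genP, aF, abF] using RingQuot.mkAlgHom_rel K (PRel.pre0 (K := K))
  pre1 := by simpa [genP, aF, abF] using RingQuot.mkAlgHom_rel K (PRel.pre1 (K := K))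
  pre2 := by simpa [genP, aF, abF] using RingQuot.mkAlgHom_rel K (PRel.pre2 (K := K))
  pre4 := genP_pre4
  pre5 := genP_pre5
  cube := pow_three_eq_zero_of_add_eq_zero genP_pre3
    (mul_cube_eq_zero (sq_eq_zero_of_add_eq_zero genP_pre4 genP_pre5))

lemma isE6System_genD (F : FreeAlgebra K (Fin 2)) : IsE6System (genD K F) where
  idem v w := by
    simpa [genD, eF, apply_ite] using RingQuot.mkAlgHom_rel K (DRel.idem (K := K) (F := F) v w)
  sum_idem := by simpa [genD, eF] using RingQuot.mkAlgHom_rel K (DRel.sum_idem (K := K) (F := F))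
  srcA i := by simpa [genD, eF, aF] using RingQuot.mkAlgHom_rel K (DRel.srcA (F := F) i)
  tgtA i := by simpa [genD, eF, aF] using RingQuot.mkAlgHom_rel K (DRel.tgtA (F := F) i)
  srcAb i := by simpa [genD, eF, abF] using RingQuot.mkAlgHom_rel K (DRel.srcAb (F := F) i)
  tgtAb i := by simpa [genD, eF, abF] using RingQuot.mkAlgHom_rel K (DRel.tgtAb (F := F) i)
  pre0 := by simpa [genD, aF, abF] using RingQuot.mkAlgHom_rel K (DRel.pre0 (F := F))
  pre1 := by simpa [genD, aF, abF] using RingQuot.mkAlgHom_rel K (DRel.pre1 (F := F))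
  pre2 := by simpa [genD, aF, abF] using RingQuot.mkAlgHom_rel K (DRel.pre2 (F := F))
  pre4 := by simpa [genD, aF, abF] using RingQuot.mkAlgHom_rel K (DRel.pre4 (F := F))
  pre5 := by simpa [genD, aF, abF] using RingQuot.mkAlgHom_rel K (DRel.pre5 (F := F))
  cube := by simpa [genD, aF, abF] using RingQuot.mkAlgHom_rel K (DRel.cube (F := F))

lemma lift_genD (F G : FreeAlgebra K (Fin 2)) : FreeAlgebra.lift K (genD K F) (subst K G) =
    RingQuot.mkAlgHom K (DRel K F) (subst K G) := by
  congr 1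
  ext i
  simp [genD]

lemma genD_pre3 (F : FreeAlgebra K (Fin 2)) :
    genD K F (.abar 0) * genD K F (.a 0) + genD K F (.abar 2) * genD K F (.a 2)
    + genD K F (.a 3) * genD K F (.abar 3) + FreeAlgebra.lift K (genD K F) (subst K F) = 0 := by
  rw [lift_genD]
  simpa [genD, aF, abF] using RingQuot.mkAlgHom_rel K (DRel.pre3 (F := F))

/-- Twisting commutes with homomorphisms fixing the loops at the vertex `3`. -/
lemma map_twistGen {T' : Type*} [Ring T'] [Algebra K T'] {g : E6Gen → T} {g' : E6Gen → T'}
    (hg : IsE6System g) (hg' : IsE6System g') {α β α' β' : RE6 K} (Φ : T →ₐ[K] T')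
    (hΦ : ∀ i, Φ (g i) = twistGen g' (hg'.loopHom K α') (hg'.loopHom K β') i)
    (hα : α * α' = 1) (hβ : β' * β = 1) (i : E6Gen) :
    Φ (twistGen g (hg.loopHom K α) (hg.loopHom K β) i) = g' i := by
  have hloop (r : RE6 K) : Φ (hg.loopHom K r) = hg'.loopHom K r := by
    induction r using RE6.induction with
    | scalar c => simp
    | hx => simp [hΦ, twistGen]
    | hy => simp [hΦ, twistGen]
    | add a b ha hb => simp [ha, hb]
    | mul a b ha hb => simp [ha, hb]
  rcases i with v | i | i
  · simp [twistGen, hΦ]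
  · by_cases hi : i = 3
    · simp only [twistGen, hi, if_true, map_mul, hloop, hΦ]
      rw [← mul_assoc, ← map_mul, hα, map_one, one_mul]
    · simp [twistGen, hΦ, hi]
  · by_cases hi : i = 3
    · simp only [twistGen, hi, if_true, map_mul, hloop, hΦ]
      rw [mul_assoc, ← map_mul, hβ, map_one, mul_one]
    · simp [twistGen, hΦ, hi]

end Twist

/-- **Main Theorem.** Every deformed preprojective algebra of Dynkin type `E₆` is
isomorphic to the preprojective algebra of Dynkin type `E₆`: for every `F` whose
image `f` in `R(E₆)` lies in `(rad R(E₆))²` and is admissible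
(`(x + y + f)³ = 0`), the algebras `P^f(E₆)` and `P(E₆)` are isomorphic. -/
theorem deformed_iso_preprojective [IsAlgClosed K] (F : FreeAlgebra K (Fin 2))
    (hrad : RingQuot.mkAlgHom K (RRel K) F ∈ radSq K)
    (hadm : (rx K + ry K + RingQuot.mkAlgHom K (RRel K) F) ^ 3 = 0) :
    Nonempty (PfE6 K F ≃ₐ[K] PE6 K) := by
  obtain ⟨α, β, t, c, d, hαβ, ht, hcd⟩ := exists_units_of_admissible (radSq_le hrad) hadm
  have hP := isE6System_genP (K := K)
  have hD := isE6System_genD F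
  have hPloop : hP.loopHom K (rx K + ry K) + genP K (.a 3) * genP K (.abar 3) = 0 := by
    simpa using genP_pre3 (K := K)
  have hDloop : hD.loopHom K (rx K + ry K + RingQuot.mkAlgHom K (RRel K) F)
      + genD K F (.a 3) * genD K F (.abar 3) = 0 := by
    rw [map_add, hD.loopHom_mk, add_right_comm]
    simpa using genD_pre3 F
  have hP' := hP.twist (K := K) (α := (α : RE6 K)) (β := (β : RE6 K))
    (by rw [ht]; exact hP.loop_three_insert hPloop _ _)
  have hD' := hD.twist (K := K) (α := ((α⁻¹ : (RE6 K)ˣ) : RE6 K))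
    (β := ((β⁻¹ : (RE6 K)ˣ) : RE6 K)) (by rw [hcd]; exact hD.loop_three_insert hDloop _ _)
  have hP3 := hP.twist_loop_three hPloop hαβ
  have hD3 := hD.twist_loop_three (α := ((α⁻¹ : (RE6 K)ˣ) : RE6 K))
    (β := ((β⁻¹ : (RE6 K)ˣ) : RE6 K)) (m' := rx K + ry K) hDloop (by
    rw [← hαβ, mul_assoc, Units.mul_inv_cancel_right, Units.inv_mul_cancel_left])
  let Φ : PfE6 K F →ₐ[K] PE6 K := hP'.liftD (by
    rw [hP3, hP.lift_twistGen_subst, map_add, map_add, hP.loopHom_rx, hP.loopHom_ry]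
    exact add_neg_add_eq_zero _ _)
  let Ψ : PE6 K →ₐ[K] PfE6 K F := hD'.liftP (by
    rw [hD3, map_add, hD.loopHom_rx, hD.loopHom_ry]
    exact add_neg_cancel _)
  have hΦ (i) : Φ (genD K F i) = _ := hP'.liftD_mk _ i
  have hΨ (i) : Ψ (genP K i) = _ := hD'.liftP_mk _ i
  refine ⟨AlgEquiv.ofAlgHom Φ Ψ ?_ ?_⟩
  · apply RingQuot.ringQuot_ext'
    ext i
    change Φ (Ψ (genP K i)) = genP K i
    rw [hΨ]
    exact map_twistGen hD hP Φ hΦ α.inv_mul β.mul_inv i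
  · apply RingQuot.ringQuot_ext'
    ext i
    change Ψ (Φ (genD K F i)) = genD K F i
    rw [hΦ]
    exact map_twistGen hP hD Ψ hΨ α.mul_inv β.inv_mul i
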